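/- Writing H^d_n(m) := rank([P_{i+j}] + [(P̌_m)_{i+j}]), the following values hold: H^4_4(0) = 11, H^4_4(−1) = 12, H^5_4(0) = 24, H^5_4(−1) = 24, H^6_4(0) = 38, H^6_4(−1) = 38, H^4_6(1) = 36, H^4_6(0) = 38, H^4_6(−1) = 38, where H^d_n(m) refers to dimension n and degree d. -/

import Mathlib

open Finset Matrix

/-- `ζ_{2d} = exp(2πi/(2d))`. -/
noncomputable def zeta2d (d : ℕ) : ℂ :=
  Complex.exp (2 * Real.pi * Complex.I / (2 * (d : ℂ)))

/-- The even-position index `2e` in `{0,…,n+1}` (with `n = 2h`). -/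
def evIdx (h : ℕ) (e : Fin (h + 1)) : Fin (2 * h + 2) :=
  ⟨2 * e.1, by have := e.isLt; omega⟩

/-- The odd-position index `2e+1` in `{0,…,n+1}` (with `n = 2h`). -/
def odIdx (h : ℕ) (e : Fin (h + 1)) : Fin (2 * h + 2) :=
  ⟨2 * e.1 + 1, by have := e.isLt; omega⟩

/-- The index set `I_N`: tuples `(i_0,…,i_{n+1})` with `0 ≤ i_e ≤ d-2` and `∑ i_e = N`,
for `n = 2h` even. -/
abbrev IdxSet (h d N : ℕ) : Type :=
  {i : Fin (2 * h + 2) → Fin (d - 1) // ∑ e, (i e).1 = N}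

/-- The period vector `p^{a,b}` of the linear cycle `ℙ^{n/2}_{a,b}` in the Fermat variety,
extended by zero to all integer tuples. -/
noncomputable def pvec (h d : ℕ) (a : Fin (h + 1) → ℕ) (b : Equiv.Perm (Fin (2 * h + 2)))
    (i : Fin (2 * h + 2) → ℕ) : ℂ :=
  if ∀ e : Fin (h + 1), i (b (evIdx h e)) + i (b (odIdx h e)) = d - 2 then
    zeta2d d ^ (∑ e : Fin (h + 1), (i (b (evIdx h e)) + 1) * (1 + 2 * a e))
  else 0

/-- The period matrix `[p_{i+j}]` with rows indexed by `I_{(n/2)d-n-2}` and columns by `I_d`. -/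
noncomputable def pmat (h d : ℕ) (p : (Fin (2 * h + 2) → ℕ) → ℂ) :
    Matrix (IdxSet h d (h * d - (2 * h + 2))) (IdxSet h d d) ℂ :=
  Matrix.of fun i j => p fun e => (i.1 e).1 + (j.1 e).1

/-- The period vector `P` of the linear cycle with `a = (0,…,0)` and `b = id`. -/
noncomputable def Pvec (h d : ℕ) : (Fin (2 * h + 2) → ℕ) → ℂ :=
  pvec h d (fun _ => 0) (Equiv.refl _)

/-- The period vector `P̌_m` (with `μ = m+1`): `a` has first `μ` entries `0`, the rest `1`,
and `b = id`. -/
noncomputable def PcheckVec (h d μ : ℕ) : (Fin (2 * h + 2) → ℕ) → ℂ :=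
  pvec h d (fun e => if e.1 < μ then 0 else 1) (Equiv.refl _)

/-- The combinatorial constant `C_{α_1,…,α_s}`. -/
def Ccoef (n d : ℕ) {s : ℕ} (α : Fin s → ℕ) : ℤ :=
  ((n + 1 + d).choose (n + 1) : ℤ) -
    ∑ k ∈ Finset.Icc 1 s, (-1 : ℤ) ^ (k - 1) *
      ∑ T ∈ Finset.univ.filter (fun T : Finset (Fin s) => T.card = k ∧ ∑ i ∈ T, α i ≤ d),
        (((n + 1 + d - ∑ i ∈ T, α i).choose (n + 1) : ℤ))

/-- The sequence `x^s, y^t` (x repeated s times followed by y repeated t times). -/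
def twoBlock (x y s t : ℕ) : Fin (s + t) → ℕ := fun i => if i.1 < s then x else y

/-- `K^d_n(m) = 2·C_{1^{n/2+1},(d-1)^{n/2+1}} − C_{1^{n−m+1},(d−1)^{m+1}}`, with `n = 2h`,
`μ = m+1`. -/
def Kdef (h d μ : ℕ) : ℤ :=
  2 * Ccoef (2 * h) d (twoBlock 1 (d - 1) (h + 1) (h + 1)) -
    Ccoef (2 * h) d (twoBlock 1 (d - 1) (2 * h + 2 - μ) μ)

/-- `H^d_n(m)`: the rank of `[P_{i+j}] + [(P̌_m)_{i+j}]`, with `n = 2h` and `μ = m+1`. -/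
noncomputable def sumRank (h d μ : ℕ) : ℕ :=
  (pmat h d (Pvec h d) + pmat h d (PcheckVec h d μ)).rank

/-! ### Proof: block decomposition by pair sums -/

theorem rank_eq_sum_blocks {m n S α β : Type} [Fintype m] [Fintype n] [Fintype S]
    [DecidableEq S] [DecidableEq α] [DecidableEq β]
    (M : Matrix m n ℂ) (F : m → α) (G : n → β) (ι : S → α) (κ : S → β)
    (hι : Function.Injective ι) (hκ : Function.Injective κ) (r : S → ℕ)
    (hzero : ∀ i j, (∀ s, ¬ (F i = ι s ∧ G j = κ s)) → M i j = 0)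
    (a : ∀ s, Fin (r s) → m → ℂ) (b : ∀ s, Fin (r s) → n → ℂ)
    (hblock : ∀ s i j, F i = ι s → G j = κ s → M i j = ∑ k, a s k i * b s k j)
    (ρ : ∀ s, Fin (r s) → m) (γ : ∀ s, Fin (r s) → n)
    (hρ : ∀ s k, F (ρ s k) = ι s) (hγ : ∀ s k, G (γ s k) = κ s)
    (hdet : ∀ s, (Matrix.of fun k l => M (ρ s k) (γ s l)).det ≠ 0) :
    M.rank = ∑ s, r s := by
  have hcard : Fintype.card (Σ s, Fin (r s)) = ∑ s, r s := by simp
  rw [← hcard]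
  apply le_antisymm
  · have hM : M = (Matrix.of fun i (p : Σ s, Fin (r s)) => if F i = ι p.1 then a p.1 p.2 i else 0) *
        (Matrix.of fun (p : Σ s, Fin (r s)) j => if G j = κ p.1 then b p.1 p.2 j else 0) := by
      ext i j
      rw [Matrix.mul_apply, Fintype.sum_sigma]
      simp only [Matrix.of_apply]
      by_cases h : ∃ s, F i = ι s ∧ G j = κ s
      · obtain ⟨s, h1, h2⟩ := h
        rw [Finset.sum_eq_single s]
        · simp only [h1, h2, if_true]
          exact hblock s i j h1 h2
        · intro s' _ hs'
          apply Finset.sum_eq_zero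
          intro k _
          rw [if_neg, zero_mul]
          intro h3
          exact hs' (hι (h3.symm.trans h1))
        · simp
      · push Not at h
        rw [hzero i j (fun s hs => h s hs.1 hs.2)]
        symm
        apply Finset.sum_eq_zero
        intro s _
        apply Finset.sum_eq_zero
        intro k _
        by_cases h1 : F i = ι s
        · rw [if_neg (h s h1), mul_zero]
        · rw [if_neg h1, zero_mul]
    rw [hM]
    exact (Matrix.rank_mul_le_left _ _).trans (Matrix.rank_le_card_width _)
  · have hsub := Matrix.rank_submatrix_le M (fun p : Σ s, Fin (r s) => ρ p.1 p.2)
      (fun p : Σ s, Fin (r s) => γ p.1 p.2)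
    refine le_trans (le_of_eq ?_) hsub
    symm
    apply Matrix.rank_of_det_ne_zero
    intro h0
    obtain ⟨x, hx0, hx⟩ := Matrix.exists_mulVec_eq_zero_iff.2 h0
    apply hx0
    funext ⟨s, k⟩
    have hs : (Matrix.of fun k l => M (ρ s k) (γ s l)) *ᵥ (fun l => x ⟨s, l⟩) = 0 := by
      funext k
      have := congrFun hx ⟨s, k⟩
      simp only [Matrix.mulVec, dotProduct, Fintype.sum_sigma, Matrix.submatrix_apply] at this
      rw [Finset.sum_eq_single s] at this
      · simpa [Matrix.mulVec, dotProduct] using this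
      · intro s' _ hs'
        apply Finset.sum_eq_zero
        intro l _
        rw [hzero, zero_mul]
        rintro s'' ⟨h1, h2⟩
        rw [hρ] at h1
        rw [hγ] at h2
        exact hs' ((hκ h2).trans (hι h1).symm)
      · simp
    exact congrFun (Matrix.eq_zero_of_mulVec_eq_zero (hdet s) hs) k

theorem sum_pairs (h : ℕ) (g : Fin (2 * h + 2) → ℕ) :
    ∑ x, g x = ∑ e : Fin (h + 1), (g (evIdx h e) + g (odIdx h e)) := by
  have key : ∀ (f : ℕ → ℕ) (k : ℕ),
      ∑ x ∈ range (2 * k), f x = ∑ e ∈ range k, (f (2 * e) + f (2 * e + 1)) := by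
    intro f k
    induction k with
    | zero => simp
    | succ k ih =>
      rw [show 2 * (k + 1) = 2 * k + 1 + 1 by ring, sum_range_succ, sum_range_succ,
        sum_range_succ, ih, add_assoc]
  rw [Finset.sum_fin_eq_sum_range]
  refine (key _ (h + 1)).trans ?_
  rw [Finset.sum_fin_eq_sum_range]
  apply Finset.sum_congr rfl
  intro e he
  have he' := Finset.mem_range.1 he
  rw [dif_pos (by omega), dif_pos (by omega), dif_pos he']
  rfl

/-- The tuple with even entries `c` and pair sums `s`. -/
def mkIdx (h d N : ℕ) (s : Fin (h + 1) → ℕ) (hs : ∀ e, s e < d - 1) (hN : ∑ e, s e = N)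
    (c : Fin (h + 1) → ℕ) (hc : ∀ e, c e ≤ s e) : IdxSet h d N :=
  ⟨fun x =>
    if x.1 % 2 = 0 then
      ⟨c ⟨x.1 / 2, by omega⟩, lt_of_le_of_lt (hc _) (hs _)⟩
    else
      ⟨s ⟨x.1 / 2, by omega⟩ - c ⟨x.1 / 2, by omega⟩, lt_of_le_of_lt (Nat.sub_le _ _) (hs _)⟩, by
    rw [sum_pairs, ← hN]
    apply Finset.sum_congr rfl
    intro e _
    have h1 : (2 * e.1 + 1) % 2 = 1 := by omega
    have h2 : (2 * e.1 + 1) / 2 = e.1 := by omega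
    have := hc e
    simp only [evIdx, odIdx, h1, h2]
    simp
    omega⟩

theorem mkIdx_ev (h d N : ℕ) (s) (hs) (hN) (c) (hc) (e : Fin (h + 1)) :
    ((mkIdx h d N s hs hN c hc).1 (evIdx h e)).1 = c e := by
  simp [mkIdx, evIdx]

theorem mkIdx_od (h d N : ℕ) (s) (hs) (hN) (c) (hc) (e : Fin (h + 1)) :
    ((mkIdx h d N s hs hN c hc).1 (odIdx h e)).1 = s e - c e := by
  have h1 : (2 * e.1 + 1) % 2 = 1 := by omega
  have h2 : (2 * e.1 + 1) / 2 = e.1 := by omega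
  simp [mkIdx, odIdx, h1, h2]

/-- Pair sums of a tuple. -/
def pairSum {h d N : ℕ} (i : IdxSet h d N) (e : Fin (h + 1)) : ℕ :=
  (i.1 (evIdx h e)).1 + (i.1 (odIdx h e)).1

theorem pairSum_mkIdx (h d N : ℕ) (s) (hs) (hN) (c) (hc) :
    pairSum (mkIdx h d N s hs hN c hc) = s := by
  funext e
  rw [pairSum, mkIdx_ev, mkIdx_od]
  have := hc e
  omega

/-- The monomial weight of a tuple. -/
noncomputable def wt {h d N : ℕ} (a : Fin (h + 1) → ℕ) (i : IdxSet h d N) : ℂ :=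
  zeta2d d ^ (∑ e : Fin (h + 1), (i.1 (evIdx h e)).1 * (1 + 2 * a e))

theorem zeta2d_sq_ne_one (d : ℕ) (hd : 2 ≤ d) : zeta2d d ^ 2 ≠ 1 := by
  have h := Complex.isPrimitiveRoot_exp (2 * d) (by omega)
  have h2 : zeta2d d = Complex.exp (2 * Real.pi * Complex.I / ((2 * d : ℕ) : ℂ)) := by
    simp [zeta2d]
  rw [h2]
  exact h.pow_ne_one_of_pos_of_lt (by norm_num) (by omega)

theorem zeta2d_ne_zero (d : ℕ) : zeta2d d ≠ 0 := Complex.exp_ne_zero _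

/-- If some pair past `μ` has positive sum, the two weights are independent on the block. -/
theorem exists_indep (h d N μ : ℕ) (hd : 2 ≤ d) (s : Fin (h + 1) → ℕ) (hs : ∀ e, s e < d - 1)
    (hN : ∑ e, s e = N) (e₀ : Fin (h + 1)) (he₀ : ¬ e₀.1 < μ) (hpos : s e₀ ≠ 0) :
    ∃ ρ : Fin 2 → IdxSet h d N, (∀ k, pairSum (ρ k) = s) ∧
      wt (fun _ => 0) (ρ 0) * wt (fun e => if e.1 < μ then 0 else 1) (ρ 1) -
      wt (fun _ => 0) (ρ 1) * wt (fun e => if e.1 < μ then 0 else 1) (ρ 0) ≠ 0 := by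
  have hc : ∀ e, (if e = e₀ then 1 else 0) ≤ s e := by
    intro e
    split_ifs with h1
    · subst h1; omega
    · omega
  refine ⟨![mkIdx h d N s hs hN (fun _ => 0) (fun _ => Nat.zero_le _),
    mkIdx h d N s hs hN (fun e => if e = e₀ then 1 else 0) hc], ?_, ?_⟩
  · intro k
    fin_cases k
    · exact pairSum_mkIdx h d N s hs hN (fun _ => 0) (fun _ => Nat.zero_le _)
    · exact pairSum_mkIdx h d N s hs hN (fun e => if e = e₀ then 1 else 0) hc
  · simp only [Matrix.cons_val_zero, Matrix.cons_val_one, wt, mkIdx_ev]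
    simp [he₀]
    have h1 := zeta2d_sq_ne_one d hd
    have h0 := zeta2d_ne_zero d
    intro h2
    have h3 : zeta2d d * (zeta2d d ^ 2 - 1) = 0 := by linear_combination h2
    rcases mul_eq_zero.1 h3 with h4 | h4
    · exact h0 h4
    · exact h1 (sub_eq_zero.1 h4)

theorem exists_base (h d N : ℕ) (s : Fin (h + 1) → ℕ) (hs : ∀ e, s e < d - 1)
    (hN : ∑ e, s e = N) : ∃ i : IdxSet h d N, pairSum i = s :=
  ⟨mkIdx h d N s hs hN (fun _ => 0) (fun _ => Nat.zero_le _), pairSum_mkIdx ..⟩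

theorem wt_ne_zero {h d N : ℕ} (a : Fin (h + 1) → ℕ) (i : IdxSet h d N) : wt a i ≠ 0 :=
  pow_ne_zero _ (zeta2d_ne_zero d)

/-- If all pairs past `μ` have zero sum, the two weights coincide on the block. -/
theorem wt_eq {h d N : ℕ} (μ : ℕ) (i : IdxSet h d N)
    (hi : ∀ e : Fin (h + 1), ¬ e.1 < μ → pairSum i e = 0) :
    wt (fun e => if e.1 < μ then 0 else 1) i = wt (fun _ => 0) i := by
  unfold wt
  congr 1
  apply Finset.sum_congr rfl
  intro e _
  by_cases he : e.1 < μ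
  · simp [he]
  · have := hi e he
    unfold pairSum at this
    have h0 : (i.1 (evIdx h e)).1 = 0 := by omega
    simp [h0]

/-- The number of components of a block. -/
def blockRank (h d μ : ℕ) (s : Fin (h + 1) → Fin (d - 1)) : ℕ :=
  if (∀ e : Fin (h + 1), ¬ e.1 < μ → (s e).1 = 0) ∨
    (∀ e : Fin (h + 1), ¬ e.1 < μ → (s e).1 = d - 2) then 1 else 2

/-- A constant for the period vector. -/
noncomputable def cst (h d : ℕ) (a : Fin (h + 1) → ℕ) : ℂ :=
  zeta2d d ^ (∑ e : Fin (h + 1), (1 + 2 * a e))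

theorem pvec_block {h d N N' : ℕ} (a : Fin (h + 1) → ℕ) (i : IdxSet h d N) (j : IdxSet h d N')
    (hij : ∀ e, pairSum i e + pairSum j e = d - 2) :
    pvec h d a (Equiv.refl _) (fun e => (i.1 e).1 + (j.1 e).1) = cst h d a * (wt a i * wt a j) := by
  unfold pvec
  rw [if_pos]
  · rw [cst, wt, wt, ← pow_add, ← pow_add, ← Finset.sum_add_distrib, ← Finset.sum_add_distrib]
    congr 1
    apply Finset.sum_congr rfl
    intro e _
    simp only [Equiv.refl_apply]
    ring
  · intro e
    have := hij e
    unfold pairSum at this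
    simp only [Equiv.refl_apply]
    omega

theorem pvec_zero {h d N N' : ℕ} (a : Fin (h + 1) → ℕ) (i : IdxSet h d N) (j : IdxSet h d N')
    (hij : ¬ ∀ e, pairSum i e + pairSum j e = d - 2) :
    pvec h d a (Equiv.refl _) (fun e => (i.1 e).1 + (j.1 e).1) = 0 := by
  unfold pvec
  rw [if_neg]
  intro hh
  apply hij
  intro e
  have := hh e
  simp only [Equiv.refl_apply] at this
  unfold pairSum
  omega

/-- Rank-two or rank-one data for a single block. -/
theorem block_data (h d N N' μ : ℕ) (hd : 3 ≤ d) (hμ : μ ≤ h)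
    (s : Fin (h + 1) → Fin (d - 1)) (hs : ∑ e, (s e).1 = N)
    (hs' : ∑ e, (d - 2 - (s e).1) = N') :
    ∃ (a : Fin (blockRank h d μ s) → IdxSet h d N → ℂ)
      (b : Fin (blockRank h d μ s) → IdxSet h d N' → ℂ)
      (ρ : Fin (blockRank h d μ s) → IdxSet h d N) (γ : Fin (blockRank h d μ s) → IdxSet h d N'),
      (∀ i j, pairSum i = (fun e => (s e).1) → pairSum j = (fun e => d - 2 - (s e).1) →
        cst h d (fun _ => 0) * (wt (fun _ => 0) i * wt (fun _ => 0) j) +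
        cst h d (fun e => if e.1 < μ then 0 else 1) *
          (wt (fun e => if e.1 < μ then 0 else 1) i * wt (fun e => if e.1 < μ then 0 else 1) j)
          = ∑ k, a k i * b k j) ∧
      (∀ k, pairSum (ρ k) = (fun e => (s e).1)) ∧
      (∀ k, pairSum (γ k) = (fun e => d - 2 - (s e).1)) ∧
      (Matrix.of fun k l => ∑ x, a x (ρ k) * b x (γ l)).det ≠ 0 := by
  have hlt : ∀ e, (s e).1 < d - 1 := fun e => (s e).2
  have hlt' : ∀ e, d - 2 - (s e).1 < d - 1 := fun e => by omega
  have hc0 : cst h d (fun _ => 0) ≠ 0 := pow_ne_zero _ (zeta2d_ne_zero d)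
  have hc1 : cst h d (fun e => if e.1 < μ then 0 else 1) ≠ 0 := pow_ne_zero _ (zeta2d_ne_zero d)
  set c0 := cst h d (fun _ => 0)
  set c1 := cst h d (fun e => if e.1 < μ then 0 else 1)
  by_cases hA : ∀ e : Fin (h + 1), ¬ e.1 < μ → (s e).1 = 0
  · have hr : blockRank h d μ s = 1 := by simp only [blockRank]; rw [if_pos (Or.inl hA)]
    rw [hr]
    let e₀ : Fin (h + 1) := ⟨h, by omega⟩
    have he₀ : ¬ e₀.1 < μ := by simp [e₀]; omega
    obtain ⟨γ, hγ, hγd⟩ := exists_indep h d N' μ (by omega) (fun e => d - 2 - (s e).1) hlt' hs' e₀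
      he₀ (by simp only [hA e₀ he₀]; omega)
    obtain ⟨i₀, hi₀⟩ := exists_base h d N (fun e => (s e).1) hlt hs
    have hex : ∃ j : IdxSet h d N', pairSum j = (fun e => d - 2 - (s e).1) ∧
        c0 * wt (fun _ => 0) j + c1 * wt (N := N') (fun e => if e.1 < μ then 0 else 1) j ≠ 0 := by
      by_contra hcon
      push Not at hcon
      have h0 := hcon _ (hγ 0)
      have h1 := hcon _ (hγ 1)
      apply hγd
      apply mul_left_cancel₀ hc1
      linear_combination wt (fun _ => 0) (γ 0) * h1 - wt (fun _ => 0) (γ 1) * h0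
    obtain ⟨j₀, hj₀, hne⟩ := hex
    refine ⟨fun _ i => wt (fun _ => 0) i,
      fun _ j => c0 * wt (fun _ => 0) j + c1 * wt (fun e => if e.1 < μ then 0 else 1) j,
      fun _ => i₀, fun _ => j₀, ?_, fun _ => hi₀, fun _ => hj₀, ?_⟩
    · intro i j hi hj
      rw [wt_eq μ i (fun e he => by rw [hi]; exact hA e he)]
      simp only [Fin.sum_univ_one]
      ring
    · rw [Matrix.det_fin_one]
      simpa using ⟨wt_ne_zero _ _, hne⟩
  by_cases hB : ∀ e : Fin (h + 1), ¬ e.1 < μ → (s e).1 = d - 2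
  · have hr : blockRank h d μ s = 1 := by simp only [blockRank]; rw [if_pos (Or.inr hB)]
    rw [hr]
    let e₀ : Fin (h + 1) := ⟨h, by omega⟩
    have he₀ : ¬ e₀.1 < μ := by simp [e₀]; omega
    obtain ⟨γ, hγ, hγd⟩ := exists_indep h d N μ (by omega) (fun e => (s e).1) hlt hs e₀
      he₀ (by simp only [hB e₀ he₀]; omega)
    obtain ⟨j₀, hj₀⟩ := exists_base h d N' (fun e => d - 2 - (s e).1) hlt' hs'
    have hex : ∃ i : IdxSet h d N, pairSum i = (fun e => (s e).1) ∧
        c0 * wt (fun _ => 0) i + c1 * wt (N := N) (fun e => if e.1 < μ then 0 else 1) i ≠ 0 := by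
      by_contra hcon
      push Not at hcon
      have h0 := hcon _ (hγ 0)
      have h1 := hcon _ (hγ 1)
      apply hγd
      apply mul_left_cancel₀ hc1
      linear_combination wt (fun _ => 0) (γ 0) * h1 - wt (fun _ => 0) (γ 1) * h0
    obtain ⟨i₀, hi₀, hne⟩ := hex
    refine ⟨fun _ i => c0 * wt (fun _ => 0) i + c1 * wt (fun e => if e.1 < μ then 0 else 1) i,
      fun _ j => wt (fun _ => 0) j,
      fun _ => i₀, fun _ => j₀, ?_, fun _ => hi₀, fun _ => hj₀, ?_⟩
    · intro i j hi hj
      rw [wt_eq μ j (fun e he => by rw [hj]; simp only [hB e he]; omega)]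
      simp only [Fin.sum_univ_one]
      ring
    · rw [Matrix.det_fin_one]
      simpa using ⟨hne, wt_ne_zero _ _⟩
  · have hr : blockRank h d μ s = 2 := by
      simp only [blockRank]; rw [if_neg (not_or.2 ⟨hA, hB⟩)]
    rw [hr]
    push Not at hA hB
    obtain ⟨e₁, he₁, hp₁⟩ := hA
    obtain ⟨e₂, he₂, hp₂⟩ := hB
    obtain ⟨ρ, hρ, hρd⟩ := exists_indep h d N μ (by omega) (fun e => (s e).1) hlt hs e₁
      (by omega) hp₁
    obtain ⟨γ, hγ, hγd⟩ := exists_indep h d N' μ (by omega) (fun e => d - 2 - (s e).1) hlt' hs' e₂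
      (by omega) (by have := hlt e₂; omega)
    refine ⟨![fun i => c0 * wt (fun _ => 0) i,
        fun i => c1 * wt (fun e => if e.1 < μ then 0 else 1) i],
      ![fun j => wt (fun _ => 0) j, fun j => wt (fun e => if e.1 < μ then 0 else 1) j],
      ρ, γ, ?_, hρ, hγ, ?_⟩
    · intro i j _ _
      simp only [Fin.sum_univ_two, Matrix.cons_val_zero, Matrix.cons_val_one]
      ring
    · rw [Matrix.det_fin_two]
      simp only [Fin.sum_univ_two, Matrix.cons_val_zero, Matrix.cons_val_one, Matrix.of_apply]
      intro h0
      apply mul_ne_zero (mul_ne_zero hc0 hc1) (mul_ne_zero hρd hγd)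
      linear_combination h0

theorem sumRank_eq (h d μ : ℕ) (hd : 3 ≤ d) (hμ : μ ≤ h) (hN : 2 * h + 2 ≤ h * d) :
    sumRank h d μ = ∑ s : {s : Fin (h + 1) → Fin (d - 1) //
      ∑ e, (s e).1 = h * d - (2 * h + 2)}, blockRank h d μ s.1 := by
  have hsum : ∀ s : {s : Fin (h + 1) → Fin (d - 1) // ∑ e, (s e).1 = h * d - (2 * h + 2)},
      ∑ e, (d - 2 - (s.1 e).1) = d := by
    intro s
    have h1 : ∑ e, ((s.1 e).1 + (d - 2 - (s.1 e).1)) = (h + 1) * (d - 2) := by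
      rw [Finset.sum_congr rfl (g := fun _ => d - 2)]
      · simp
      · intro e _
        have := (s.1 e).2
        omega
    rw [Finset.sum_add_distrib, s.2] at h1
    obtain ⟨k, rfl⟩ : ∃ k, d = k + 2 := ⟨d - 2, by omega⟩
    simp only [Nat.add_sub_cancel] at h1 ⊢
    have e1 : h * (k + 2) = h * k + 2 * h := by ring
    have e2 : (h + 1) * k = h * k + k := by ring
    omega
  choose a b ρ γ hab hρ hγ hdet using
    fun s : {s : Fin (h + 1) → Fin (d - 1) // ∑ e, (s e).1 = h * d - (2 * h + 2)} =>
      block_data h d (h * d - (2 * h + 2)) d μ hd hμ s.1 s.2 (hsum s)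
  have hblock : ∀ s : {s : Fin (h + 1) → Fin (d - 1) // ∑ e, (s e).1 = h * d - (2 * h + 2)},
      ∀ i j, pairSum i = (fun e => (s.1 e).1) → pairSum j = (fun e => d - 2 - (s.1 e).1) →
      (pmat h d (Pvec h d) + pmat h d (PcheckVec h d μ)) i j = ∑ k, a s k i * b s k j := by
    intro s i j hi hj
    rw [← hab s i j hi hj]
    have hij : ∀ e, pairSum i e + pairSum j e = d - 2 := by
      intro e
      rw [hi, hj]
      have := (s.1 e).2
      simp only
      omega
    simp only [Matrix.add_apply, pmat, Matrix.of_apply, Pvec, PcheckVec]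
    rw [pvec_block _ i j hij, pvec_block _ i j hij]
  unfold sumRank
  refine rank_eq_sum_blocks _ pairSum pairSum (fun s e => (s.1 e).1)
    (fun s e => d - 2 - (s.1 e).1) ?_ ?_ _ ?_ a b hblock ρ γ hρ hγ ?_
  · intro s s' hss
    apply Subtype.ext
    funext e
    exact Fin.ext (congrFun hss e)
  · intro s s' hss
    apply Subtype.ext
    funext e
    apply Fin.ext
    have := congrFun hss e
    have h1 := (s.1 e).2
    have h2 := (s'.1 e).2
    simp only at this
    omega
  · intro i j hij
    have hne : ¬ ∀ e, pairSum i e + pairSum j e = d - 2 := by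
      intro hall
      refine hij ⟨fun e => ⟨pairSum i e, ?_⟩, ?_⟩ ⟨rfl, ?_⟩
      · have := hall e
        omega
      · simp only [pairSum]
        exact (sum_pairs h (fun x => (i.1 x).1)).symm.trans i.2
      · funext e
        have := hall e
        simp only
        omega
    simp only [Matrix.add_apply, pmat, Matrix.of_apply, Pvec, PcheckVec]
    rw [pvec_zero _ i j hne, pvec_zero _ i j hne, add_zero]
  · intro s
    convert hdet s using 2
    ext k l
    simp only [Matrix.of_apply]
    exact hblock s _ _ (hρ s k) (hγ s l)

/-- The values `H^4_4(0)=11`, `H^4_4(−1)=12`, `H^5_4(0)=24`, `H^5_4(−1)=24`,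
`H^6_4(0)=38`, `H^6_4(−1)=38`, `H^4_6(1)=36`, `H^4_6(0)=38`, `H^4_6(−1)=38`
(superscript = degree `d`, subscript = dimension `n = 2h`, `μ = m+1`). -/
theorem rank_table_quartic_quintic_sextic :
    sumRank 2 4 1 = 11 ∧ sumRank 2 4 0 = 12 ∧
    sumRank 2 5 1 = 24 ∧ sumRank 2 5 0 = 24 ∧
    sumRank 2 6 1 = 38 ∧ sumRank 2 6 0 = 38 ∧
    sumRank 3 4 2 = 36 ∧ sumRank 3 4 1 = 38 ∧ sumRank 3 4 0 = 38 := by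
  refine ⟨?_, ?_, ?_, ?_, ?_, ?_, ?_, ?_, ?_⟩ <;>
    rw [sumRank_eq _ _ _ (by norm_num) (by norm_num) (by norm_num)] <;>
    decide +kernel
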